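/- For the cycle graph C_n with fixed vertex q, the number of effective divisors of degree k linearly equivalent to kq equals the number of binary necklaces with n black beads and k white beads; equivalently, #|kq| = (1/(n+k)) Σ_{d | gcd(n,k)} φ(d) C((n+k)/d, n/d). -/

import Mathlib

/-- The Laplacian matrix of the cycle graph `C_n` (vertices `ZMod n`). -/
def cycLap (n : ℕ) : Matrix (ZMod n) (ZMod n) ℤ :=
  Matrix.of fun i j =>
    (if i = j then 2 else 0) - (if j = i + 1 then 1 else 0) - (if j = i - 1 then 1 else 0)

lemma cycLap_mulVec (n : ℕ) [NeZero n] (f : ZMod n → ℤ) (i : ZMod n) :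
    (cycLap n).mulVec f i = 2 * f i - f (i + 1) - f (i - 1) := by
  simp [cycLap, Matrix.mulVec, dotProduct, sub_mul, Finset.sum_sub_distrib]

lemma exists_prim (n : ℕ) [NeZero n] (h : ZMod n → ℤ) (hs : ∑ i, h i = 0) :
    ∃ g : ZMod n → ℤ, ∀ i, h i = g i - g (i - 1) := by
  have hs' : ∑ m ∈ Finset.range n, h (m : ZMod n) = 0 := by
    rw [← hs]
    refine Finset.sum_bij (fun m _ => (m : ZMod n)) (by simp) ?_ ?_ (by simp)
    · intro a ha b hb hab
      have := congrArg ZMod.val hab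
      rwa [ZMod.val_cast_of_lt (by simpa using ha), ZMod.val_cast_of_lt (by simpa using hb)] at this
    · intro b _
      exact ⟨b.val, by simpa using ZMod.val_lt b, by simp⟩
  refine ⟨fun i => ∑ m ∈ Finset.range (i.val + 1), h (m : ZMod n), fun i => ?_⟩
  have key : (∑ m ∈ Finset.range ((i-1).val + 1), h (m : ZMod n))
      = ∑ m ∈ Finset.range i.val, h (m : ZMod n) := by
    by_cases hi : i = 0
    · subst hi
      have : (0 - 1 : ZMod n).val + 1 = n := by
        obtain ⟨m, rfl⟩ := Nat.exists_eq_succ_of_ne_zero (NeZero.ne n)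
        simp [ZMod.val_neg_one]
      rw [this, hs']; simp
    · have hv : i.val ≠ 0 := by simpa using hi
      have : (i - 1).val = i.val - 1 := by
        have h1 : i - 1 = ((i.val - 1 : ℕ) : ZMod n) := by
          rw [Nat.cast_sub (by omega)]; simp
        rw [h1, ZMod.val_cast_of_lt]
        have := ZMod.val_lt i
        omega
      rw [this, Nat.sub_add_cancel (by omega)]
  simp only [key, Finset.sum_range_succ]
  simp

lemma lap_iff (n : ℕ) [NeZero n] (D : ZMod n → ℤ) :
    (∃ f : ZMod n → ℤ, D = (cycLap n).mulVec f) ↔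
      ∑ i, D i = 0 ∧ ∑ i : ZMod n, i * (D i : ZMod n) = 0 := by
  have e1 : ∀ {M : Type} [AddCommMonoid M] (F : ZMod n → M), ∑ i, F (i + 1) = ∑ i, F i :=
    fun F => Equiv.sum_comp (Equiv.addRight (1 : ZMod n)) F
  have e2 : ∀ {M : Type} [AddCommMonoid M] (F : ZMod n → M), ∑ i, F (i - 1) = ∑ i, F i :=
    fun F => Equiv.sum_comp (Equiv.subRight (1 : ZMod n)) F
  constructor
  · rintro ⟨f, rfl⟩
    simp only [cycLap_mulVec]
    constructor
    · rw [Finset.sum_sub_distrib, Finset.sum_sub_distrib, e1, e2, ← Finset.mul_sum]; ring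
    · have h1 := e1 (fun i => (i - 1) * (f i : ZMod n))
      have h2 := e2 (fun i => (i + 1) * (f i : ZMod n))
      simp only [add_sub_cancel_right, sub_add_cancel] at h1 h2
      push_cast
      simp only [mul_sub, Finset.sum_sub_distrib]
      rw [h1, h2, ← Finset.sum_sub_distrib, ← Finset.sum_sub_distrib]
      exact Finset.sum_eq_zero fun i _ => by ring
  · rintro ⟨h0, h1⟩
    obtain ⟨g, hg⟩ := exists_prim n D h0
    have hgs : ((∑ i, g i : ℤ) : ZMod n) = 0 := by
      have h2 := e2 (fun i => (i + 1) * (g i : ZMod n))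
      simp only [sub_add_cancel] at h2
      simp only [hg, Int.cast_sub, mul_sub, Finset.sum_sub_distrib] at h1
      rw [h2, ← Finset.sum_sub_distrib] at h1
      push_cast
      rw [← neg_eq_zero, ← h1, ← Finset.sum_neg_distrib]
      exact Finset.sum_congr rfl fun i _ => by ring
    rw [ZMod.intCast_zmod_eq_zero_iff_dvd] at hgs
    obtain ⟨c, hc⟩ := hgs
    obtain ⟨f, hf⟩ := exists_prim n (fun i => g i - c) (by simp [Finset.sum_sub_distrib, hc, ZMod.card])
    refine ⟨fun i => - f (i - 1), funext fun i => ?_⟩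
    rw [cycLap_mulVec]
    have a := hf i
    have b := hf (i - 1)
    have c := hg i
    simp only [add_sub_cancel_right]
    linarith

lemma card_div (n k : ℕ) [NeZero n] :
    Nat.card {E : ZMod n → ℤ // (∀ v, 0 ≤ E v) ∧
        ∃ f : ZMod n → ℤ, E - Pi.single 0 (k : ℤ) = (cycLap n).mulVec f}
    = ((Finset.univ.finsuppAntidiag k : Finset (ZMod n →₀ ℕ)).filter
        fun e => ∑ i : ZMod n, i * (e i : ZMod n) = 0).card := by
  rw [← Fintype.card_coe, ← Nat.card_eq_fintype_card]
  have key : ∀ E : ZMod n → ℤ, (∃ f : ZMod n → ℤ, E - Pi.single 0 (k : ℤ) = (cycLap n).mulVec f) ↔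
      (∑ i, E i = k ∧ ∑ i : ZMod n, i * (E i : ZMod n) = 0) := by
    intro E
    rw [lap_iff]
    have h1 : ∑ i, (E - Pi.single 0 (k : ℤ) : ZMod n → ℤ) i = ∑ i, E i - k := by
      simp [Finset.sum_sub_distrib]
    have h2 : ∑ i : ZMod n, i * (((E - Pi.single 0 (k : ℤ) : ZMod n → ℤ) i : ℤ) : ZMod n)
        = ∑ i : ZMod n, i * (E i : ZMod n) := by
      refine Finset.sum_congr rfl fun i _ => ?_
      by_cases hi : i = 0
      · simp [hi]
      · simp [hi]
    rw [h1, h2, sub_eq_zero]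
  symm
  refine Nat.card_eq_of_bijective (fun e => ⟨fun i => (e.1 i : ℤ), fun v => by positivity, ?_⟩) ⟨?_, ?_⟩
  · have := e.2
    rw [Finset.mem_filter, Finset.mem_finsuppAntidiag] at this
    rw [key]
    refine ⟨by exact_mod_cast this.1.1, by simpa using this.2⟩
  · intro a b hab
    ext i
    have := congrFun (congrArg Subtype.val hab) i
    simpa using this
  · rintro ⟨E, hE, hf⟩
    rw [key] at hf
    have hn : ∀ i, ((E i).toNat : ℤ) = E i := fun i => Int.toNat_of_nonneg (hE i)
    have hn' : ∀ i, ((E i).toNat : ZMod n) = (E i : ZMod n) := fun i => by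
      rw [← hn i]; simp
    refine ⟨⟨Finsupp.equivFunOnFinite.symm fun i => (E i).toNat, ?_⟩, ?_⟩
    · rw [Finset.mem_filter, Finset.mem_finsuppAntidiag]
      refine ⟨⟨?_, by simp⟩, ?_⟩
      · zify
        rw [← hf.1]
        exact Finset.sum_congr rfl fun i _ => hn i
      · rw [← hf.2]
        exact Finset.sum_congr rfl fun i _ => congrArg _ (hn' i)
    · ext i
      exact hn i

lemma prim_prod (d : ℕ) (hd : 0 < d) (z : ℂ) (hz : IsPrimitiveRoot z d) :
    ∏ b ∈ Finset.range d, (1 - PowerSeries.C (z ^ b) * PowerSeries.X) = 1 - (PowerSeries.X : PowerSeries ℂ) ^ d := by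
  have hz' : IsPrimitiveRoot (PowerSeries.C z) d := hz.map_of_injective PowerSeries.C_injective
  have := hz'.pow_sub_pow_eq_prod_sub_mul 1 (PowerSeries.X : PowerSeries ℂ) hd
  rw [one_pow] at this
  rw [this]
  refine Finset.prod_bij (fun b _ => PowerSeries.C z ^ b) ?_ ?_ ?_ (by simp)
  · intro b _
    rw [Polynomial.mem_nthRootsFinset hd, ← pow_mul, mul_comm, pow_mul, hz'.pow_eq_one, one_pow]
  · intro a ha b hb
    exact hz'.pow_inj (by simpa using ha) (by simpa using hb)
  · intro b hb
    rw [Polynomial.mem_nthRootsFinset hd] at hb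
    have : NeZero d := ⟨hd.ne'⟩
    obtain ⟨i, hi, h⟩ := hz'.eq_pow_of_pow_eq_one hb
    exact ⟨i, by simpa using hi, h⟩

lemma prim_prod' (d m : ℕ) (hd : 0 < d) (z : ℂ) (hz : IsPrimitiveRoot z d) :
    ∏ b ∈ Finset.range (d * m), (1 - PowerSeries.C (z ^ b) * PowerSeries.X) = (1 - (PowerSeries.X : PowerSeries ℂ) ^ d) ^ m := by
  induction m with
  | zero => simp
  | succ m ih =>
    rw [mul_add, mul_one, Finset.prod_range_add, ih, pow_succ, ← prim_prod d hd z hz]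
    simp [pow_add, pow_mul, hz.pow_eq_one]

lemma addChar_sum {n : ℕ} (ψ : AddChar (ZMod n) ℂ) {ι : Type*} (s : Finset ι) (f : ι → ZMod n) :
    ψ (∑ i ∈ s, f i) = ∏ i ∈ s, ψ (f i) := by
  classical
  induction s using Finset.induction_on with
  | empty => simp
  | insert a s ha ih => rw [Finset.sum_insert ha, Finset.prod_insert ha, AddChar.map_add_eq_mul, ih]

lemma char_sum (n k : ℕ) [NeZero n] (j : ZMod n) :
    ∑ e ∈ (Finset.univ.finsuppAntidiag k : Finset (ZMod n →₀ ℕ)),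
      ZMod.stdAddChar (j * ∑ i : ZMod n, i * (e i : ZMod n)) =
    if addOrderOf j ∣ k then
      (((n / addOrderOf j - 1 + k / addOrderOf j).choose (n / addOrderOf j - 1) : ℕ) : ℂ) else 0 := by
  set d := addOrderOf j with hd
  have hdpos : 0 < d := addOrderOf_pos j
  have hdn : d ∣ n := by simpa [ZMod.card] using addOrderOf_dvd_card (x := j)
  set z : ℂ := ZMod.stdAddChar j with hz
  have hpow : ∀ m : ℕ, z ^ m = ZMod.stdAddChar ((m : ZMod n) * j) := by
    intro m
    rw [hz, ← AddChar.map_nsmul_eq_pow, nsmul_eq_mul]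
  have hprim : IsPrimitiveRoot z d := by
    rw [IsPrimitiveRoot.iff_def]
    constructor
    · rw [hpow, ← nsmul_eq_mul, addOrderOf_nsmul_eq_zero, AddChar.map_zero_eq_one]
    · intro l hl
      rw [hpow, ← AddChar.map_zero_eq_one (ZMod.stdAddChar (N := n))] at hl
      have := ZMod.injective_stdAddChar hl
      rw [← nsmul_eq_mul] at this
      exact addOrderOf_dvd_of_nsmul_eq_zero this
  have hP : ∏ i : ZMod n, (1 - PowerSeries.C (z ^ i.val) * PowerSeries.X) = (1 - (PowerSeries.X : PowerSeries ℂ) ^ d) ^ (n / d) := by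
    rw [← prim_prod' d (n/d) hdpos z hprim, Nat.mul_div_cancel' hdn]
    refine Finset.prod_bij (fun i _ => i.val) ?_ ?_ ?_ (by simp)
    · intro i _; simpa using ZMod.val_lt i
    · intro i _ j _ h; exact ZMod.val_injective n h
    · intro b hb; exact ⟨b, by simp, ZMod.val_cast_of_lt (by simpa using hb)⟩
  have hQ : (∏ i : ZMod n, (PowerSeries.mk fun m => (z ^ i.val) ^ m : PowerSeries ℂ)) *
     (1 - (PowerSeries.X : PowerSeries ℂ) ^ d) ^ (n / d) = 1 := by
    rw [← hP, ← Finset.prod_mul_distrib]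
    refine Finset.prod_eq_one fun i _ => ?_
    have := congrArg (PowerSeries.rescale (z ^ i.val)) (PowerSeries.mk_one_mul_one_sub_eq_one ℂ)
    rw [map_mul, map_sub, map_one, PowerSeries.rescale_X] at this
    refine Eq.trans ?_ this
    congr 1
    ext m; simp
  have hm : 0 < n / d := Nat.div_pos (Nat.le_of_dvd (NeZero.pos n) hdn) hdpos
  have hR : (PowerSeries.expand d hdpos.ne' (PowerSeries.mk fun m => (((n/d-1) + m).choose (n/d-1) : ℂ) : PowerSeries ℂ)) *
     (1 - (PowerSeries.X : PowerSeries ℂ) ^ d) ^ (n / d) = 1 := by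
    have := congrArg (PowerSeries.expand d hdpos.ne') (PowerSeries.mk_add_choose_mul_one_sub_pow_eq_one ℂ (n/d-1))
    rw [Nat.sub_add_cancel hm] at this
    simpa using this
  have hQR := (left_inv_eq_right_inv hQ ((mul_comm _ _).trans hR))
  have := congrArg (PowerSeries.coeff k) hQR
  rw [PowerSeries.coeff_prod, PowerSeries.coeff_expand] at this
  simp only [PowerSeries.coeff_mk] at this
  refine Eq.trans ?_ this
  refine Finset.sum_congr rfl fun e _ => ?_
  simp only [hpow, ← AddChar.map_nsmul_eq_pow]
  rw [Finset.mul_sum, addChar_sum]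
  refine Finset.prod_congr rfl fun i _ => ?_
  congr 1
  rw [nsmul_eq_mul, ZMod.natCast_zmod_val]
  ring

lemma sum_order (n : ℕ) [NeZero n] (F : ℕ → ℕ) :
    ∑ j : ZMod n, F (addOrderOf j) = ∑ d ∈ n.divisors, d.totient * F d := by
  rw [← Finset.sum_fiberwise_of_maps_to (g := fun j : ZMod n => addOrderOf j) (t := n.divisors)]
  · refine Finset.sum_congr rfl fun d hd => ?_
    rw [Finset.sum_congr rfl (g := fun _ => F d) (fun x hx => by rw [(Finset.mem_filter.1 hx).2]),
      Finset.sum_const, smul_eq_mul]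
    congr 1
    exact IsAddCyclic.card_addOrderOf_eq_totient (by simpa [ZMod.card] using Nat.dvd_of_mem_divisors hd)
  · intro j _
    rw [Nat.mem_divisors]
    exact ⟨by simpa [ZMod.card] using addOrderOf_dvd_card (x := j), NeZero.ne n⟩

lemma sum_order' (n a N : ℕ) [NeZero n] (hab : N = Nat.gcd n a) (F : ℕ → ℕ) :
    ∑ j : ZMod n, (if addOrderOf j ∣ a then F (addOrderOf j) else 0)
      = ∑ d ∈ N.divisors, d.totient * F d := by
  rw [sum_order n (fun d => if d ∣ a then F d else 0)]
  simp only [mul_ite, mul_zero]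
  rw [← Finset.sum_filter]
  congr 1
  ext d
  subst hab
  simp [Nat.mem_divisors, Nat.dvd_gcd_iff, NeZero.ne n]

lemma part1 (n k : ℕ) [NeZero n] :
    (n + k) * ((Finset.univ.finsuppAntidiag k : Finset (ZMod n →₀ ℕ)).filter
        fun e => ∑ i : ZMod n, i * (e i : ZMod n) = 0).card =
     ∑ d ∈ (Nat.gcd n k).divisors, d.totient * ((n + k) / d).choose (n / d) := by
  have h1 : n * ((Finset.univ.finsuppAntidiag k : Finset (ZMod n →₀ ℕ)).filter
        fun e => ∑ i : ZMod n, i * (e i : ZMod n) = 0).card =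
      ∑ j : ZMod n, (if addOrderOf j ∣ k then
      ((n / addOrderOf j - 1 + k / addOrderOf j).choose (n / addOrderOf j - 1)) else 0) := by
    have h : (∑ j : ZMod n, ∑ e ∈ (Finset.univ.finsuppAntidiag k : Finset (ZMod n →₀ ℕ)),
      ZMod.stdAddChar (j * ∑ i : ZMod n, i * (e i : ZMod n)) : ℂ) = _ :=
        Finset.sum_congr rfl fun j _ => char_sum n k j
    rw [Finset.sum_comm] at h
    simp only [AddChar.sum_mulShift _ (ZMod.isPrimitive_stdAddChar n), ZMod.card] at h
    rw [← Nat.cast_inj (R := ℂ)]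
    push_cast
    rw [← h, Finset.card_filter]
    push_cast
    rw [Finset.mul_sum]
    simp
  rw [sum_order' n k _ rfl (fun d => (n / d - 1 + k / d).choose (n / d - 1))] at h1
  have hn := NeZero.pos n
  apply Nat.eq_of_mul_eq_mul_left hn
  rw [mul_left_comm, h1, Finset.mul_sum, Finset.mul_sum]
  refine Finset.sum_congr rfl fun d hd => ?_
  rw [Nat.mem_divisors, Nat.dvd_gcd_iff] at hd
  obtain ⟨⟨⟨a, ha⟩, ⟨b, hb⟩⟩, -⟩ := hd
  have hd0 : 0 < d := Nat.pos_of_ne_zero (by rintro rfl; simp at ha; omega)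
  obtain ⟨a, rfl⟩ := Nat.exists_eq_succ_of_ne_zero (show a ≠ 0 by rintro rfl; simp at ha; omega)
  have e1 : n / d = a + 1 := by rw [ha]; exact Nat.mul_div_cancel_left _ hd0
  have e2 : k / d = b := by rw [hb]; exact Nat.mul_div_cancel_left _ hd0
  have e3 : (n + k) / d = a + b + 1 := by
    rw [ha, hb, ← mul_add, Nat.mul_div_cancel_left _ hd0]; omega
  rw [e1, e2, e3, Nat.add_sub_cancel]
  have := Nat.add_one_mul_choose_eq (a + b) a
  have e4 : n + k = d * (a + b + 1) := by rw [ha, hb, Nat.succ_eq_add_one]; ring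
  rw [e4, ha, Nat.succ_eq_add_one]
  linear_combination (d * d.totient) * this

lemma fixed_count (N n : ℕ) [NeZero N] (r : ZMod N) :
    Nat.card {w : ZMod N → Bool // (Finset.univ.filter fun i => w i = true).card = n ∧
      ∀ i, w (i + r) = w i} =
      if addOrderOf r ∣ n then (N / addOrderOf r).choose (n / addOrderOf r) else 0 := by
  classical
  set d := addOrderOf r with hd
  have hdpos : 0 < d := addOrderOf_pos r
  let H := AddSubgroup.zmultiples r
  have hH : Nat.card H = d := Nat.card_zmultiples r
  have hQ : Nat.card (ZMod N ⧸ H) = N / d := by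
    have := H.card_eq_card_quotient_mul_card_addSubgroup
    rw [hH, Nat.card_zmod] at this
    exact (Nat.div_eq_of_eq_mul_left hdpos this).symm
  have hcard : ∀ S : Finset (ZMod N ⧸ H),
      (Finset.univ.filter fun i : ZMod N => decide ((i : ZMod N ⧸ H) ∈ S) = true).card = d * S.card := by
    intro S
    have := Nat.card_congr (QuotientAddGroup.preimageMkEquivAddSubgroupProdSet H (S : Set (ZMod N ⧸ H)))
    rw [Nat.card_prod, hH] at this
    simp only [Nat.card_coe_set_eq, Set.ncard_coe_finset] at this
    rw [← this, ← Set.ncard_coe_finset]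
    congr 1
    ext; simp
  have hbij : Nat.card {S : Finset (ZMod N ⧸ H) // d * S.card = n} =
    Nat.card {w : ZMod N → Bool // (Finset.univ.filter fun i => w i = true).card = n ∧
      ∀ i, w (i + r) = w i} := by
    refine Nat.card_eq_of_bijective (fun S => ⟨fun i => decide ((i : ZMod N ⧸ H) ∈ S.1), ?_, ?_⟩) ⟨?_, ?_⟩
    · rw [hcard, S.2]
    · intro i
      have : ((i + r : ZMod N) : ZMod N ⧸ H) = (i : ZMod N ⧸ H) := by
        rw [QuotientAddGroup.mk_add_of_mem]
        exact AddSubgroup.mem_zmultiples r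
      simp only [this]
    · rintro ⟨S, hS⟩ ⟨T, hT⟩ h
      ext q
      obtain ⟨i, rfl⟩ := QuotientAddGroup.mk_surjective q
      have := congrFun (congrArg Subtype.val h) i
      simpa using this
    · rintro ⟨w, hw, hr⟩
      have hz : ∀ (m : ℕ) i, w (i + m • r) = w i := by
        intro m
        induction m with
        | zero => simp
        | succ m ih => intro i; rw [succ_nsmul, ← add_assoc, hr, ih]
      have hz' : ∀ i j : ZMod N, (i : ZMod N ⧸ H) = (j : ZMod N ⧸ H) → w i = w j := by
        intro i j hij
        rw [QuotientAddGroup.eq] at hij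
        obtain ⟨m, hm⟩ := (AddSubmonoid.mem_multiples_iff _ _).1 (mem_multiples_iff_mem_zmultiples.2 hij)
        rw [← hz m i, hm, add_neg_cancel_left]
      have hS : (fun i : ZMod N => decide ((i : ZMod N ⧸ H) ∈ Finset.univ.filter (fun q : ZMod N ⧸ H => w q.out = true))) = w := by
        funext i
        have : w (Quotient.out (i : ZMod N ⧸ H)) = w i := hz' _ _ (Quotient.out_eq _)
        simp [this]
      refine ⟨⟨Finset.univ.filter (fun q : ZMod N ⧸ H => w q.out = true), ?_⟩, ?_⟩
      · rw [← hcard, ← hw]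
        congr 1
        ext i
        simp only [Finset.mem_filter, Finset.mem_univ, true_and]
        rw [← congrFun hS i]
        simp
      · exact Subtype.ext hS
  rw [← hbij]
  split_ifs with h
  · obtain ⟨m, rfl⟩ := h
    rw [Nat.mul_div_cancel_left _ hdpos, ← hQ, Nat.card_eq_fintype_card (α := ZMod N ⧸ H), ← Finset.card_univ,
      ← Finset.card_powersetCard, ← Fintype.card_coe, ← Nat.card_eq_fintype_card]
    refine Nat.card_congr (Equiv.subtypeEquivRight fun S => ?_)
    simp [Finset.mem_powersetCard, hdpos.ne']
  · have : IsEmpty {S : Finset (ZMod N ⧸ H) // d * S.card = n} := ⟨fun S => h ⟨_, S.2.symm⟩⟩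
    simp

def Wd (N n : ℕ) [NeZero N] := {w : ZMod N → Bool // (Finset.univ.filter fun i => w i = true).card = n}

instance (N n : ℕ) [NeZero N] : AddAction (ZMod N) (Wd N n) where
  vadd r w := ⟨fun i => w.1 (i + r), by
    refine Eq.trans ?_ w.2
    exact Finset.card_equiv (Equiv.addRight r) (by simp)⟩
  zero_vadd w := Subtype.ext (funext fun i => congrArg w.1 (add_zero i))
  add_vadd r s w := Subtype.ext (funext fun i => congrArg w.1 (by ring))

lemma part2 (N n : ℕ) [NeZero N] :
    N * Nat.card (Quot (fun w w' :
          {w : ZMod N → Bool // (Finset.univ.filter fun i => w i = true).card = n} =>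
          ∃ r : ZMod N, ∀ i, w'.1 i = w.1 (i + r))) =
     ∑ d ∈ (Nat.gcd N n).divisors, d.totient * (N / d).choose (n / d) := by
  classical
  rw [← sum_order' N n _ rfl (fun d => (N / d).choose (n / d))]
  have hfin : Finite (Wd N n) := by unfold Wd; infer_instance
  have := Fintype.ofFinite (Wd N n)
  have : ∀ g : ZMod N, Fintype (AddAction.fixedBy (Wd N n) g) := fun g => Fintype.ofFinite _
  have : Fintype (Quotient (AddAction.orbitRel (ZMod N) (Wd N n))) := Fintype.ofFinite _
  have B := AddAction.sum_card_fixedBy_eq_card_orbits_mul_card_addGroup (ZMod N) (Wd N n)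
  rw [ZMod.card, mul_comm, ← Nat.card_eq_fintype_card] at B
  have e : Nat.card (Quot (fun w w' :
          {w : ZMod N → Bool // (Finset.univ.filter fun i => w i = true).card = n} =>
          ∃ r : ZMod N, ∀ i, w'.1 i = w.1 (i + r))) = 
          Nat.card (Quotient (AddAction.orbitRel (ZMod N) (Wd N n))) := by
    refine Nat.card_congr (Quot.congrRight fun w w' => ?_)
    change _ ↔ (AddAction.orbitRel (ZMod N) (Wd N n)) w w'
    refine Iff.trans ?_ (Setoid.comm' (AddAction.orbitRel (ZMod N) (Wd N n)))
    constructor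
    · rintro ⟨r, hr⟩
      exact ⟨r, Subtype.ext (funext fun i => (hr i).symm)⟩
    · rintro ⟨r, hr⟩
      exact ⟨r, fun i => (congrFun (congrArg Subtype.val hr) i).symm⟩
  rw [e, ← B]
  refine Finset.sum_congr rfl fun r _ => ?_
  rw [← fixed_count, ← Nat.card_eq_fintype_card]
  refine Nat.card_congr ?_
  refine ⟨fun w => ⟨w.1.1, w.1.2, fun i => congrFun (congrArg Subtype.val w.2) i⟩,
    fun w => ⟨⟨w.1, w.2.1⟩, Subtype.ext (funext w.2.2)⟩, fun w => rfl, fun w => rfl⟩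

lemma part2' (N n : ℕ) (hN : N ≠ 0) :
    N * Nat.card (Quot (fun w w' :
          {w : Fin N → Bool // (Finset.univ.filter fun i => w i = true).card = n} =>
          ∃ r : Fin N, ∀ i, w'.1 i = w.1 (i + r))) =
     ∑ d ∈ (Nat.gcd N n).divisors, d.totient * (N / d).choose (n / d) := by
  obtain ⟨m, rfl⟩ := Nat.exists_eq_succ_of_ne_zero hN
  exact part2 (m + 1) n


/-- On the cycle graph `C_n` (with `q = 0`), `#|kq|` equals the number
of binary necklaces with `n` black and `k` white beads, and
`(n+k)·#|kq| = ∑_{d ∣ gcd(n,k)} φ(d)·C((n+k)/d, n/d)`. -/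
theorem stmt14 (n k : ℕ) [NeZero n] (hn : 3 ≤ n) :
    Nat.card {E : ZMod n → ℤ // (∀ v, 0 ≤ E v) ∧
        ∃ f : ZMod n → ℤ, E - Pi.single 0 (k : ℤ) = (cycLap n).mulVec f}
      = Nat.card (Quot (fun w w' :
          {w : Fin (n + k) → Bool // (Finset.univ.filter fun i => w i = true).card = n} =>
          ∃ r : Fin (n + k), ∀ i, w'.1 i = w.1 (i + r))) ∧
    (n + k) * Nat.card {E : ZMod n → ℤ // (∀ v, 0 ≤ E v) ∧
        ∃ f : ZMod n → ℤ, E - Pi.single 0 (k : ℤ) = (cycLap n).mulVec f}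
      = ∑ d ∈ (Nat.gcd n k).divisors, d.totient * ((n + k) / d).choose (n / d) := by
  rw [card_div]
  have h1 := part1 n k
  have h2 := part2' (n + k) n (by omega)
  rw [show Nat.gcd (n + k) n = Nat.gcd n k by simp [Nat.gcd_comm]] at h2
  exact ⟨Nat.eq_of_mul_eq_mul_left (show 0 < n + k by omega) (h1.trans h2.symm), h1⟩
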